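/- For ψ in the image of div on a finite connected directed graph, ‖ψ‖_{BV*} = min { ‖g‖_{ℓ∞(S_E)} : g ∈ S_E, div g = ψ }, and the minimum is attained. -/

import Mathlib

/-- Gradient operator on a directed graph with edge source/target maps. -/
def grad {V E : Type*} (src tgt : E → V) (f : V → ℝ) : E → ℝ :=
  fun e => f (tgt e) - f (src e)

/-- Divergence operator on a directed graph: incoming minus outgoing flow. -/
def gdiv {V E : Type*} [Fintype E] [DecidableEq V] (src tgt : E → V) (g : E → ℝ) : V → ℝ :=
  fun v => (∑ e : E, if tgt e = v then g e else 0) - (∑ e : E, if src e = v then g e else 0)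

/-- Connectedness of the underlying undirected graph. -/
def GConnected {V E : Type*} (src tgt : E → V) : Prop :=
  ∀ v w : V, Relation.ReflTransGen
    (fun a b => ∃ e : E, (src e = a ∧ tgt e = b) ∨ (src e = b ∧ tgt e = a)) v w

theorem gdiv_adj {V E : Type*} [Fintype V] [Fintype E] [DecidableEq V]
    (src tgt : E → V) (g : E → ℝ) (h : V → ℝ) :
    ∑ v : V, gdiv src tgt g v * h v = ∑ e : E, g e * grad src tgt h e := by
  have key : ∀ p : E → V, ∑ v : V, (∑ e : E, if p e = v then g e else 0) * h v
      = ∑ e : E, g e * h (p e) := by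
    intro p
    simp only [Finset.sum_mul, ite_mul, zero_mul]
    rw [Finset.sum_comm]
    simp
  simp only [gdiv, grad, sub_mul, mul_sub, Finset.sum_sub_distrib, key]

/-- The divergence as a linear map. -/
def gdivLin {V E : Type*} [Fintype E] [DecidableEq V] (src tgt : E → V) :
    (E → ℝ) →ₗ[ℝ] (V → ℝ) where
  toFun := gdiv src tgt
  map_add' x y := by
    have key : ∀ (p : E → V) (v : V), (∑ e : E, if p e = v then x e + y e else 0)
      = (∑ e : E, if p e = v then x e else 0) + (∑ e : E, if p e = v then y e else 0) := by
      intro p v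
      rw [← Finset.sum_add_distrib]
      refine Finset.sum_congr rfl fun e _ => ?_
      split_ifs <;> simp
    funext v
    simp only [gdiv, Pi.add_apply, key]
    ring
  map_smul' c x := by
    funext v
    simp only [gdiv, Pi.smul_apply, smul_eq_mul, RingHom.id_apply, mul_sub, Finset.mul_sum,
      mul_ite, mul_zero]

theorem stmt7 {V E : Type*} [Fintype V] [Fintype E] [DecidableEq V]
    (src tgt : E → V) (hconn : GConnected src tgt) (ψ : V → ℝ)
    (hψ : ∃ g : E → ℝ, gdiv src tgt g = ψ) :
    ∃ g : E → ℝ, gdiv src tgt g = ψ ∧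
      (⨆ e : E, |g e|) =
        sSup {r : ℝ | ∃ h : V → ℝ, (∑ e : E, |grad src tgt h e|) ≤ 1 ∧
          r = ∑ v : V, ψ v * h v} ∧
      ∀ g' : E → ℝ, gdiv src tgt g' = ψ → (⨆ e : E, |g e|) ≤ ⨆ e : E, |g' e| := by
  obtain ⟨g₀, hg₀⟩ := hψ
  set S : Set ℝ := {r : ℝ | ∃ h : V → ℝ, (∑ e : E, |grad src tgt h e|) ≤ 1 ∧
          r = ∑ v : V, ψ v * h v} with hS
  have hub : ∀ g' : E → ℝ, gdiv src tgt g' = ψ → ∀ r ∈ S, r ≤ ⨆ e : E, |g' e| := by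
    rintro g' rfl r ⟨h, hh, rfl⟩
    rw [gdiv_adj]
    have hnn : 0 ≤ ⨆ e : E, |g' e| := Real.iSup_nonneg fun e => abs_nonneg _
    calc ∑ e : E, g' e * grad src tgt h e
        ≤ ∑ e : E, (⨆ e : E, |g' e|) * |grad src tgt h e| := by
          refine Finset.sum_le_sum fun e _ => ?_
          refine (le_abs_self _).trans ?_
          rw [abs_mul]
          exact mul_le_mul_of_nonneg_right
            (le_ciSup (f := fun e => |g' e|) (Set.finite_range _).bddAbove e) (abs_nonneg _)
      _ = (⨆ e : E, |g' e|) * ∑ e : E, |grad src tgt h e| := by rw [Finset.mul_sum]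
      _ ≤ (⨆ e : E, |g' e|) * 1 := mul_le_mul_of_nonneg_left hh hnn
      _ = _ := mul_one _
  have h0 : (0 : ℝ) ∈ S := ⟨0, by simp [grad], by simp⟩
  have hbdd : BddAbove S := ⟨_, hub g₀ hg₀⟩
  have hM : 0 ≤ sSup S := le_csSup hbdd h0
  have hle : ∀ g' : E → ℝ, gdiv src tgt g' = ψ → sSup S ≤ ⨆ e : E, |g' e| :=
    fun g' hg' => csSup_le ⟨0, h0⟩ (hub g' hg')
  have hex : ψ ∈ gdivLin src tgt '' Set.Icc (fun _ => - sSup S) (fun _ => sSup S) := by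
    by_contra hn
    obtain ⟨f, u, hf, hu⟩ := geometric_hahn_banach_closed_point
      ((convex_Icc (𝕜 := ℝ) (fun _ : E => - sSup S) (fun _ => sSup S)).linear_image
        (gdivLin src tgt))
      ((isCompact_Icc.image (LinearMap.continuous_of_finiteDimensional _)).isClosed) hn
    let h : V → ℝ := fun v => f (Pi.single v 1)
    have hfh : ∀ x : V → ℝ, f x = ∑ v, x v * h v := by
      intro x
      conv_lhs => rw [pi_eq_sum_univ' x]
      simp only [map_sum, map_smul, smul_eq_mul, h]
    let T := ∑ e : E, |grad src tgt h e|
    have h1 : sSup S * T < ∑ v, ψ v * h v := by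
      have := hf _ ⟨fun e => sSup S * SignType.sign (grad src tgt h e), ⟨?_, ?_⟩, rfl⟩
      · rw [hfh] at this hu
        change ∑ v, gdiv src tgt _ v * h v < u at this
        rw [gdiv_adj] at this
        refine lt_of_eq_of_lt ?_ (this.trans hu)
        rw [Finset.mul_sum]
        refine Finset.sum_congr rfl fun e _ => ?_
        rw [mul_assoc, sign_mul_self]
      · intro e
        rcases lt_trichotomy (grad src tgt h e) 0 with hc | hc | hc <;> simp [hc, hM]
      · intro e
        rcases lt_trichotomy (grad src tgt h e) 0 with hc | hc | hc <;> simp [hc, hM]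
    have hT : 0 ≤ T := Finset.sum_nonneg fun e _ => abs_nonneg _
    rcases hT.eq_or_lt with hT0 | hT0
    · have hz := (Finset.sum_eq_zero_iff_of_nonneg (fun e _ => abs_nonneg _)).1 hT0.symm
      rw [← hT0, mul_zero, ← hg₀, gdiv_adj] at h1
      refine h1.ne' (Finset.sum_eq_zero fun e he => ?_)
      rw [abs_eq_zero.1 (hz e he), mul_zero]
    · have hmem : (∑ v, ψ v * h v) / T ∈ S := by
        refine ⟨fun v => h v / T, le_of_eq ?_, ?_⟩
        · simp only [grad, ← sub_div, abs_div, abs_of_pos hT0]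
          rw [← Finset.sum_div]
          exact div_self hT0.ne'
        · rw [Finset.sum_div]
          simp only [mul_div_assoc]
      have := le_csSup hbdd hmem
      rw [div_le_iff₀ hT0] at this
      linarith
  obtain ⟨g, hg, hgψ⟩ := hex
  have hgle : (⨆ e : E, |g e|) ≤ sSup S :=
    Real.iSup_le (fun e => abs_le.2 ⟨hg.1 e, hg.2 e⟩) hM
  exact ⟨g, hgψ, le_antisymm hgle (hle g hgψ), fun g' hg' => hgle.trans (hle g' hg')⟩
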